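/- arXiv:2212.13111 — 4 statements merged into one kernel-verified Lean document; each statement's English description precedes it below -/
import Mathlib

section
/- In the clipping ANN setting, assume that f is non-decreasing and satisfies Lip(f) < min_{i ∈ {1,…,h}} v_i w_i, let Θ ∈ C([0, ∞), ℝ^{h+1}) be a gradient flow trajectory, let ϑ ∈ ℝ^{h+1} satisfy limsup_{t→∞} ‖Θ_t − ϑ‖ = 0, let V = sup_{x ∈ (a,b)} Σ_{i ∈ {1,…,h}, x ∈ I_i^ϑ} v_i, and assume Σ_{i=1}^h v_i · 1_{(a − 1/w_i, b)}(ψ_i(Θ_0)) > f(b) − f(a) + 4V. Then there exists i ∈ {1, …, h} such that I_i^{Θ_0} ≠ ∅ and I_i^ϑ = ∅. -/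
open MeasureTheory Filter

noncomputable section

/-- The clipping function `x ↦ min{max{x,0},1}`. -/
def clipFn (x : ℝ) : ℝ := min (max x 0) 1

/-- `ψ_i(θ) = -θ_i / w_i`. -/
def psiC {h : ℕ} (w : Fin h → ℝ) (θ : Fin (h + 1) → ℝ) (i : Fin h) : ℝ :=
  -θ i.castSucc / w i

/-- The activity interval `I_i^θ = (ψ_i(θ), ψ_i(θ) + 1/w_i) ∩ (a, b)`. -/
def actI {h : ℕ} (a b : ℝ) (w : Fin h → ℝ) (θ : Fin (h + 1) → ℝ) (i : Fin h) : Set ℝ :=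
  Set.Ioo (psiC w θ i) (psiC w θ i + (w i)⁻¹) ∩ Set.Ioo a b

/-- The realization function `N^θ(x) = θ_{h+1} + ∑_i v_i c(w_i x + θ_i)`. -/
def realC {h : ℕ} (v w : Fin h → ℝ) (θ : Fin (h + 1) → ℝ) (x : ℝ) : ℝ :=
  θ (Fin.last h) + ∑ i : Fin h, v i * clipFn (w i * x + θ i.castSucc)

/-- The risk `L(θ) = ∫_a^b (N^θ(x) - f(x))² p(x) dx`. -/
def riskC {h : ℕ} (a b : ℝ) (v w : Fin h → ℝ) (f p : ℝ → ℝ) (θ : Fin (h + 1) → ℝ) : ℝ :=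
  ∫ x in Set.Ioo a b, (realC v w θ x - f x) ^ 2 * p x

/-- The gradient `∇L(θ)` as a vector of partial derivatives. -/
def gradC {h : ℕ} (a b : ℝ) (v w : Fin h → ℝ) (f p : ℝ → ℝ) (θ : Fin (h + 1) → ℝ) :
    Fin (h + 1) → ℝ :=
  fun k => fderiv ℝ (riskC a b v w f p) θ (Pi.single k 1)

/-- `x` is a descending critical point of `g` : `∇g(x) = 0` and the Hessian quadratic form
admits a negative value. -/
def IsDescCrit {n : ℕ} (g : (Fin n → ℝ) → ℝ) (x : Fin n → ℝ) : Prop :=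
  fderiv ℝ g x = 0 ∧ ∃ u : Fin n → ℝ, iteratedFDeriv ℝ 2 g x ![u, u] < 0

/-- The Euclidean norm on `Fin n → ℝ`. -/
def euclNorm {n : ℕ} (x : Fin n → ℝ) : ℝ := Real.sqrt (∑ i, (x i) ^ 2)

/-- Piecewise polynomial functions. -/
def PiecewisePoly (F : ℝ → ℝ) : Prop :=
  ∃ (K : ℕ) (τ : ℕ → EReal), 0 < K ∧ τ 0 = ⊥ ∧ τ K = ⊤ ∧
    (∀ k, k < K → τ k < τ (k + 1)) ∧
    ∀ k, k < K → ∃ q : Polynomial ℝ, ∀ x : ℝ,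
      τ k < (x : EReal) → (x : EReal) < τ (k + 1) → F x = q.eval x

lemma clipFn_mono : Monotone clipFn := fun x y hxy => by
  unfold clipFn; gcongr

lemma abs_clipFn_sub_le (x y : ℝ) : |clipFn x - clipFn y| ≤ |x - y| := by
  refine (abs_min_sub_min_le_max _ _ _ _).trans ?_
  simpa using abs_max_sub_max_le_abs x y 0

lemma clipFn_nonneg (x : ℝ) : 0 ≤ clipFn x :=
  le_min (le_max_right _ _) zero_le_one

lemma clipFn_le_one (x : ℝ) : clipFn x ≤ 1 := min_le_right _ _

lemma clipFn_of_nonpos {x : ℝ} (hx : x ≤ 0) : clipFn x = 0 := by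
  simp [clipFn, hx]

lemma clipFn_of_one_le {x : ℝ} (hx : 1 ≤ x) : clipFn x = 1 := by
  simp [clipFn, hx]

lemma clipFn_of_mem_Icc {x : ℝ} (hx : x ∈ Set.Icc 0 1) : clipFn x = x := by
  simp [clipFn, hx.1, hx.2]

lemma continuous_clipFn : Continuous clipFn := by
  unfold clipFn; fun_prop

/-- The derivative of the clipping function away from the points `0` and `1`. -/
def clipDeriv : ℝ → ℝ := (Set.Ioo (0 : ℝ) 1).indicator 1

lemma clipDeriv_nonneg (y : ℝ) : 0 ≤ clipDeriv y :=
  Set.indicator_nonneg (fun _ _ => zero_le_one) y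

lemma clipDeriv_le_one (y : ℝ) : clipDeriv y ≤ 1 :=
  Set.indicator_le' (fun _ _ => le_rfl) (fun _ _ => zero_le_one) y

lemma measurable_clipDeriv : Measurable clipDeriv :=
  measurable_one.indicator measurableSet_Ioo

lemma hasDerivAt_clipFn {y : ℝ} (h0 : y ≠ 0) (h1 : y ≠ 1) :
    HasDerivAt clipFn (clipDeriv y) y := by
  rcases lt_or_gt_of_ne h0 with h0 | h0
  · have hd : clipDeriv y = 0 := Set.indicator_of_notMem (fun h => h0.not_gt h.1) _
    rw [hd]
    refine (hasDerivAt_const y (0 : ℝ)).congr_of_eventuallyEq ?_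
    filter_upwards [Iio_mem_nhds h0] with x hx using clipFn_of_nonpos (le_of_lt hx)
  rcases lt_or_gt_of_ne h1 with h1 | h1
  · have hd : clipDeriv y = 1 := Set.indicator_of_mem (show y ∈ Set.Ioo 0 1 from ⟨h0, h1⟩) _
    rw [hd]
    refine (hasDerivAt_id y).congr_of_eventuallyEq ?_
    filter_upwards [Ioo_mem_nhds h0 h1] with x hx
      using clipFn_of_mem_Icc (Set.Ioo_subset_Icc_self hx)
  · have hd : clipDeriv y = 0 := Set.indicator_of_notMem (fun h => h1.not_gt h.2) _
    rw [hd]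
    refine (hasDerivAt_const y (1 : ℝ)).congr_of_eventuallyEq ?_
    filter_upwards [Ioi_mem_nhds h1] with x hx using clipFn_of_one_le (le_of_lt hx)

lemma continuousAt_clipDeriv {y : ℝ} (h0 : y ≠ 0) (h1 : y ≠ 1) : ContinuousAt clipDeriv y :=
  ContinuousOn.continuousAt_indicator continuousOn_const
    (by rw [frontier_Ioo zero_lt_one]; simp [h0, h1])

/-- The derivative of `θ ↦ N^θ(x)`, valid when `x` is not a breakpoint of the network. -/
def realCFDeriv {h : ℕ} (v w : Fin h → ℝ) (θ : Fin (h + 1) → ℝ) (x : ℝ) :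
    (Fin (h + 1) → ℝ) →L[ℝ] ℝ :=
  ContinuousLinearMap.proj (Fin.last h) +
    ∑ i : Fin h, (v i * clipDeriv (w i * x + θ i.castSucc)) •
      (ContinuousLinearMap.proj i.castSucc : (Fin (h + 1) → ℝ) →L[ℝ] ℝ)

/-- The derivative in `θ` of the integrand of the risk. -/
def riskCFDeriv {h : ℕ} (v w : Fin h → ℝ) (f p : ℝ → ℝ) (θ : Fin (h + 1) → ℝ) (x : ℝ) :
    (Fin (h + 1) → ℝ) →L[ℝ] ℝ :=
  (2 * (realC v w θ x - f x) * p x) • realCFDeriv v w θ x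

section Realization

variable {h : ℕ} {v w : Fin h → ℝ}

lemma realCFDeriv_apply (θ u : Fin (h + 1) → ℝ) (x : ℝ) :
    realCFDeriv v w θ x u = u (Fin.last h) +
      ∑ i : Fin h, v i * clipDeriv (w i * x + θ i.castSucc) * u i.castSucc := by
  simp [realCFDeriv]

lemma realCFDeriv_single (θ : Fin (h + 1) → ℝ) (x : ℝ) (i : Fin h) :
    realCFDeriv v w θ x (Pi.single i.castSucc 1) =
      v i * clipDeriv (w i * x + θ i.castSucc) := by
  rw [realCFDeriv_apply, Finset.sum_eq_single i]
  · simp [(Fin.castSucc_lt_last i).ne']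
  · intro j _ hj
    simp [hj]
  · simp

lemma ae_forall_ne_breakpoint (hw : ∀ i, 0 < w i) (θ : Fin (h + 1) → ℝ) :
    ∀ᵐ x : ℝ, ∀ i, w i * x + θ i.castSucc ≠ 0 ∧ w i * x + θ i.castSucc ≠ 1 := by
  rw [ae_all_iff]
  intro i
  have key : ∀ c : ℝ, ∀ᵐ x : ℝ, w i * x + θ i.castSucc ≠ c := by
    intro c
    filter_upwards [compl_mem_ae_iff.2 (measure_singleton ((c - θ i.castSucc) / w i))] with x hx hc
    apply hx
    rw [Set.mem_singleton_iff, eq_div_iff (hw i).ne']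
    linarith
  exact (key 0).and (key 1)

lemma hasFDerivAt_realC {θ : Fin (h + 1) → ℝ} {x : ℝ}
    (hx : ∀ i, w i * x + θ i.castSucc ≠ 0 ∧ w i * x + θ i.castSucc ≠ 1) :
    HasFDerivAt (fun θ => realC v w θ x) (realCFDeriv v w θ x) θ := by
  unfold realC realCFDeriv
  refine (hasFDerivAt_apply _ _).add (HasFDerivAt.fun_sum fun i _ => ?_)
  have hin : HasFDerivAt (fun θ : Fin (h + 1) → ℝ => w i * x + θ i.castSucc)
      (ContinuousLinearMap.proj i.castSucc : (Fin (h + 1) → ℝ) →L[ℝ] ℝ) θ :=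
    (hasFDerivAt_apply (i.castSucc) θ).const_add _
  have := ((hasDerivAt_clipFn (hx i).1 (hx i).2).comp_hasFDerivAt θ hin).const_mul (v i)
  rwa [smul_smul] at this

lemma continuousAt_realCFDeriv {θ : Fin (h + 1) → ℝ} {x : ℝ}
    (hx : ∀ i, w i * x + θ i.castSucc ≠ 0 ∧ w i * x + θ i.castSucc ≠ 1) :
    ContinuousAt (fun θ => realCFDeriv v w θ x) θ := by
  unfold realCFDeriv
  refine continuousAt_const.add (tendsto_finsetSum _ fun i _ => ?_)
  have hclip : ContinuousAt
      (fun θ : Fin (h + 1) → ℝ => clipDeriv (w i * x + θ i.castSucc)) θ :=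
    ContinuousAt.comp (f := fun θ : Fin (h + 1) → ℝ => w i * x + θ i.castSucc)
      (continuousAt_clipDeriv (hx i).1 (hx i).2)
      (continuous_const.add (continuous_apply i.castSucc)).continuousAt
  exact (hclip.const_mul (v i)).smul continuousAt_const

lemma stronglyMeasurable_realCFDeriv (θ : Fin (h + 1) → ℝ) :
    StronglyMeasurable (fun x => realCFDeriv v w θ x) := by
  unfold realCFDeriv
  refine stronglyMeasurable_const.add (Finset.stronglyMeasurable_fun_sum _ fun i _ => ?_)
  refine StronglyMeasurable.smul_const (Measurable.stronglyMeasurable ?_) _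
  exact (measurable_clipDeriv.comp (by fun_prop)).const_mul _

lemma norm_realCFDeriv_le (hv : ∀ i, 0 < v i) (θ : Fin (h + 1) → ℝ) (x : ℝ) :
    ‖realCFDeriv v w θ x‖ ≤ 1 + ∑ i, v i := by
  have hV : 0 ≤ ∑ i, v i := Finset.sum_nonneg fun i _ => (hv i).le
  refine ContinuousLinearMap.opNorm_le_bound _ (by linarith) fun u => ?_
  rw [realCFDeriv_apply, add_mul, one_mul, Finset.sum_mul]
  refine (norm_add_le _ _).trans (add_le_add (norm_le_pi_norm u _) ?_)
  refine (norm_sum_le _ _).trans (Finset.sum_le_sum fun i _ => ?_)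
  rw [norm_mul, Real.norm_of_nonneg (mul_nonneg (hv i).le (clipDeriv_nonneg _))]
  have := norm_le_pi_norm u i.castSucc
  have := mul_le_of_le_one_right (hv i).le (clipDeriv_le_one (w i * x + θ i.castSucc))
  have := (hv i).le
  gcongr

lemma continuous_realC (θ : Fin (h + 1) → ℝ) : Continuous (realC v w θ) := by
  have := continuous_clipFn
  unfold realC
  fun_prop

lemma continuous_realC_param (x : ℝ) : Continuous (fun θ => realC v w θ x) := by
  have := continuous_clipFn
  unfold realC
  fun_prop

lemma abs_realC_le (hv : ∀ i, 0 < v i) (θ : Fin (h + 1) → ℝ) (x : ℝ) :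
    |realC v w θ x| ≤ ‖θ‖ + ∑ i, v i := by
  unfold realC
  refine (abs_add_le _ _).trans (add_le_add (norm_le_pi_norm θ _) ?_)
  refine (Finset.abs_sum_le_sum_abs _ _).trans (Finset.sum_le_sum fun i _ => ?_)
  rw [abs_mul, abs_of_pos (hv i), abs_of_nonneg (clipFn_nonneg _)]
  exact mul_le_of_le_one_right (hv i).le (clipFn_le_one _)

lemma abs_realC_sub_le (hv : ∀ i, 0 < v i) (θ η : Fin (h + 1) → ℝ) (x : ℝ) :
    |realC v w θ x - realC v w η x| ≤ (1 + ∑ i, v i) * ‖θ - η‖ := by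
  have hdiff : realC v w θ x - realC v w η x = (θ - η) (Fin.last h) + ∑ i : Fin h,
      v i * (clipFn (w i * x + θ i.castSucc) - clipFn (w i * x + η i.castSucc)) := by
    simp only [realC, mul_sub, Finset.sum_sub_distrib, Pi.sub_apply]
    ring
  rw [hdiff, add_mul, one_mul, Finset.sum_mul]
  refine (abs_add_le _ _).trans (add_le_add (norm_le_pi_norm (θ - η) _) ?_)
  refine (Finset.abs_sum_le_sum_abs _ _).trans (Finset.sum_le_sum fun i _ => ?_)
  rw [abs_mul, abs_of_pos (hv i)]
  refine mul_le_mul_of_nonneg_left ((abs_clipFn_sub_le _ _).trans ?_) (hv i).le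
  have := norm_le_pi_norm (θ - η) i.castSucc
  rw [add_sub_add_left_eq_sub]
  simpa using this

lemma monotone_realC (hv : ∀ i, 0 < v i) (hw : ∀ i, 0 < w i) (θ : Fin (h + 1) → ℝ) :
    Monotone (realC v w θ) := fun x y hxy => by
  unfold realC
  gcongr with i _
  · exact (hv i).le
  · refine clipFn_mono ?_
    have := mul_le_mul_of_nonneg_left hxy (hw i).le
    linarith

lemma mem_actI_iff (hw : ∀ i, 0 < w i) {a b : ℝ} {θ : Fin (h + 1) → ℝ} {i : Fin h} {x : ℝ} :
    x ∈ actI a b w θ i ↔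
      (0 < w i * x + θ i.castSucc ∧ w i * x + θ i.castSucc < 1) ∧ x ∈ Set.Ioo a b := by
  have hi := hw i
  rw [actI, Set.mem_inter_iff, Set.mem_Ioo, psiC, div_lt_iff₀ hi, inv_eq_one_div, ← add_div,
    lt_div_iff₀ hi]
  refine and_congr_left fun _ => and_congr ?_ ?_ <;> constructor <;> intro <;> linarith

end Realization

section Risk

variable {h : ℕ} {v w : Fin h → ℝ} {a b : ℝ} {f p : ℝ → ℝ}

/-- A bound for the derivative of the risk integrand on the unit ball around `θ`. -/
def riskBound (v : Fin h → ℝ) (f p : ℝ → ℝ) (θ : Fin (h + 1) → ℝ) (x : ℝ) : ℝ :=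
  2 * (‖θ‖ + 1 + ∑ i, v i + |f x|) * p x * (1 + ∑ i, v i)

lemma Continuous.integrableOn_Ioo_real {g : ℝ → ℝ} (hg : Continuous g) :
    IntegrableOn g (Set.Ioo a b) :=
  hg.integrableOn_Icc.mono_set Set.Ioo_subset_Icc_self

lemma integrable_riskBound (hf : Continuous f) (hp : Continuous p)
    (θ : Fin (h + 1) → ℝ) : IntegrableOn (riskBound v f p θ) (Set.Ioo a b) := by
  refine Continuous.integrableOn_Ioo_real ?_
  unfold riskBound
  fun_prop

lemma abs_realC_sub_target_le (hv : ∀ i, 0 < v i) {θ η : Fin (h + 1) → ℝ}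
    (hη : η ∈ Metric.ball θ 1) (x : ℝ) :
    |realC v w η x - f x| ≤ ‖θ‖ + 1 + ∑ i, v i + |f x| := by
  have h1 := abs_realC_le (w := w) hv η x
  have h2 : ‖η‖ ≤ ‖θ‖ + 1 := by
    have := norm_le_norm_add_norm_sub' η θ
    rw [mem_ball_iff_norm] at hη
    linarith
  have := abs_sub (realC v w η x) (f x)
  linarith

lemma stronglyMeasurable_riskCFDeriv (hf : Continuous f) (hp : Continuous p)
    (θ : Fin (h + 1) → ℝ) : StronglyMeasurable (riskCFDeriv v w f p θ) := by
  have := continuous_realC (v := v) (w := w) θ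
  have hcoef : Continuous (fun x => 2 * (realC v w θ x - f x) * p x) := by fun_prop
  exact hcoef.stronglyMeasurable.smul (stronglyMeasurable_realCFDeriv θ)

lemma norm_riskCFDeriv_le (hv : ∀ i, 0 < v i) (hpnn : ∀ x, 0 ≤ p x)
    {θ η : Fin (h + 1) → ℝ} (hη : η ∈ Metric.ball θ 1) (x : ℝ) :
    ‖riskCFDeriv v w f p η x‖ ≤ riskBound v f p θ x := by
  have h1 := abs_realC_sub_target_le (w := w) (f := f) hv hη x
  have h2 := norm_realCFDeriv_le (w := w) hv η x
  have h3 := hpnn x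
  have h4 : 0 ≤ ‖θ‖ + 1 + ∑ i, v i + |f x| := (abs_nonneg _).trans h1
  rw [riskCFDeriv, norm_smul, norm_mul, norm_mul, Real.norm_of_nonneg h3, Real.norm_eq_abs,
    Real.norm_eq_abs, abs_two, riskBound]
  gcongr

lemma hasFDerivAt_riskC (hv : ∀ i, 0 < v i) (hw : ∀ i, 0 < w i) (hf : Continuous f)
    (hp : Continuous p) (hpnn : ∀ x, 0 ≤ p x) (θ : Fin (h + 1) → ℝ) :
    IntegrableOn (riskCFDeriv v w f p θ) (Set.Ioo a b) ∧
    HasFDerivAt (riskC a b v w f p) (∫ x in Set.Ioo a b, riskCFDeriv v w f p θ x) θ := by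
  have hcont : ∀ η : Fin (h + 1) → ℝ,
      Continuous (fun x => (realC v w η x - f x) ^ 2 * p x) := fun η => by
    have := continuous_realC (v := v) (w := w) η
    fun_prop
  refine hasFDerivAt_integral_of_dominated_loc_of_lip (bound := riskBound v f p θ)
    (F := fun η x => (realC v w η x - f x) ^ 2 * p x)
    (Metric.ball_mem_nhds θ one_pos)
    (Eventually.of_forall fun η => (hcont η).aestronglyMeasurable)
    (hcont θ).integrableOn_Ioo_real
    (stronglyMeasurable_riskCFDeriv hf hp θ).aestronglyMeasurable
    (ae_of_all _ fun x => ?_) (integrable_riskBound hf hp θ) (ae_restrict_of_ae ?_)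
  · refine LipschitzOnWith.of_dist_le_mul fun η hη ζ hζ => ?_
    have h1 := abs_realC_sub_target_le (w := w) (f := f) hv hη x
    have h2 := abs_realC_sub_target_le (w := w) (f := f) hv hζ x
    have h3 := abs_realC_sub_le (w := w) hv η ζ x
    have h4 := hpnn x
    have hM := (abs_nonneg _).trans h1
    rw [Real.coe_nnabs, dist_eq_norm η ζ, Real.dist_eq]
    have hfac : (realC v w η x - f x) ^ 2 * p x - (realC v w ζ x - f x) ^ 2 * p x =
        ((realC v w η x - f x) + (realC v w ζ x - f x)) * p x *
          (realC v w η x - realC v w ζ x) := by ring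
    rw [hfac, abs_mul, abs_mul, abs_of_nonneg h4]
    calc _ ≤ (2 * (‖θ‖ + 1 + ∑ i, v i + |f x|)) * p x * ((1 + ∑ i, v i) * ‖η - ζ‖) := by
          gcongr
          exact (abs_add_le _ _).trans (by linarith)
      _ = riskBound v f p θ x * ‖η - ζ‖ := by unfold riskBound; ring
      _ ≤ _ := by gcongr; exact le_abs_self _
  · filter_upwards [ae_forall_ne_breakpoint hw θ] with x hx
    have := (((hasFDerivAt_realC (v := v) hx).sub_const (f x)).pow 2).mul_const (p x)
    refine this.congr_fderiv ?_
    ext u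
    simp [riskCFDeriv]
    ring

lemma continuous_fderiv_riskC (hv : ∀ i, 0 < v i) (hw : ∀ i, 0 < w i) (hf : Continuous f)
    (hp : Continuous p) (hpnn : ∀ x, 0 ≤ p x) :
    Continuous (fderiv ℝ (riskC a b v w f p)) := by
  have hfd : fderiv ℝ (riskC a b v w f p) =
      fun θ => ∫ x in Set.Ioo a b, riskCFDeriv v w f p θ x :=
    funext fun θ => (hasFDerivAt_riskC hv hw hf hp hpnn θ).2.fderiv
  rw [hfd, continuous_iff_continuousAt]
  intro θ
  refine continuousAt_of_dominated (bound := riskBound v f p θ)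
    (Eventually.of_forall fun η =>
      (stronglyMeasurable_riskCFDeriv hf hp η).aestronglyMeasurable) ?_
    (integrable_riskBound hf hp θ) (ae_restrict_of_ae ?_)
  · filter_upwards [Metric.ball_mem_nhds θ one_pos] with η hη
    exact ae_of_all _ (norm_riskCFDeriv_le hv hpnn hη)
  · filter_upwards [ae_forall_ne_breakpoint hw θ] with x hx
    have := (continuous_realC_param (v := v) (w := w) x).continuousAt (x := θ)
    have hcoef : ContinuousAt (fun θ => 2 * (realC v w θ x - f x) * p x) θ := by fun_prop
    exact hcoef.smul (continuousAt_realCFDeriv hx)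

lemma continuous_gradC (hv : ∀ i, 0 < v i) (hw : ∀ i, 0 < w i) (hf : Continuous f)
    (hp : Continuous p) (hpnn : ∀ x, 0 ≤ p x) : Continuous (gradC a b v w f p) := by
  have := continuous_fderiv_riskC (a := a) (b := b) hv hw hf hp hpnn
  refine continuous_pi fun k => ?_
  unfold gradC
  exact this.clm_apply continuous_const

lemma gradC_castSucc (hv : ∀ i, 0 < v i) (hw : ∀ i, 0 < w i) (hf : Continuous f)
    (hp : Continuous p) (hpnn : ∀ x, 0 ≤ p x) (θ : Fin (h + 1) → ℝ) (i : Fin h) :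
    gradC a b v w f p θ i.castSucc =
      2 * v i * ∫ x in actI a b w θ i, (realC v w θ x - f x) * p x := by
  obtain ⟨hint, hder⟩ := hasFDerivAt_riskC (a := a) (b := b) hv hw hf hp hpnn θ
  have hind : ∀ x ∈ Set.Ioo a b, riskCFDeriv v w f p θ x (Pi.single i.castSucc 1) =
      2 * v i * (actI a b w θ i).indicator (fun x => (realC v w θ x - f x) * p x) x := by
    intro x hx
    rw [riskCFDeriv, smul_apply, realCFDeriv_single, smul_eq_mul]
    by_cases hmem : x ∈ actI a b w θ i
    · rw [Set.indicator_of_mem hmem, clipDeriv,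
        Set.indicator_of_mem (Set.mem_Ioo.2 ((mem_actI_iff hw).1 hmem).1), Pi.one_apply]
      ring
    · rw [Set.indicator_of_notMem hmem, clipDeriv,
        Set.indicator_of_notMem fun hc => hmem ((mem_actI_iff hw).2 ⟨Set.mem_Ioo.1 hc, hx⟩)]
      ring
  rw [gradC, hder.fderiv, ContinuousLinearMap.integral_apply hint,
    setIntegral_congr_fun measurableSet_Ioo hind, integral_const_mul,
    setIntegral_indicator (show MeasurableSet (actI a b w θ i) from
      measurableSet_Ioo.inter measurableSet_Ioo),
    Set.inter_eq_right.2 (show actI a b w θ i ⊆ Set.Ioo a b from Set.inter_subset_right)]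

/-- At a critical point of the risk, the realization agrees with the target somewhere in each
nonempty activity interval. -/
lemma exists_mem_actI_realC_eq (hv : ∀ i, 0 < v i) (hw : ∀ i, 0 < w i) (hf : Continuous f)
    (hp : Continuous p) (hpnn : ∀ x, 0 ≤ p x) (hpos : ∀ x ∈ Set.Ioo a b, 0 < p x)
    {θ : Fin (h + 1) → ℝ} (hcrit : gradC a b v w f p θ = 0) {i : Fin h}
    (hi : (actI a b w θ i).Nonempty) : ∃ x ∈ actI a b w θ i, realC v w θ x = f x := by
  have hcont := continuous_realC (v := v) (w := w) θ
  have hsub : actI a b w θ i ⊆ Set.Ioo a b := Set.inter_subset_right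
  have hconn : IsConnected (actI a b w θ i) :=
    ⟨hi, (Set.ordConnected_Ioo.inter Set.ordConnected_Ioo).isPreconnected⟩
  have hopen : IsOpen (actI a b w θ i) := isOpen_Ioo.inter isOpen_Ioo
  have hpint : IntegrableOn p (actI a b w θ i) := hp.integrableOn_Ioo_real.mono_set hsub
  have hgint : IntegrableOn (fun x => (realC v w θ x - f x) * p x) (actI a b w θ i) :=
    (Continuous.integrableOn_Ioo_real (by fun_prop)).mono_set hsub
  obtain ⟨c, hc, hmean⟩ := exists_eq_const_mul_setIntegral_of_nonneg hconn hopen.measurableSet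
    (f := fun x => realC v w θ x - f x) (hcont.sub hf).continuousOn hpint hgint fun x _ => hpnn x
  have hppos : 0 < ∫ x in actI a b w θ i, p x := by
    rw [setIntegral_pos_iff_support_of_nonneg_ae (ae_of_all _ hpnn) hpint,
      Set.inter_eq_right.2
        (show actI a b w θ i ⊆ Function.support p from fun x hx => (hpos x (hsub hx)).ne')]
    exact hopen.measure_pos _ hi
  have hzero := gradC_castSucc (a := a) (b := b) hv hw hf hp hpnn θ i
  rw [hcrit, hmean, Pi.zero_apply, eq_comm, ← mul_assoc] at hzero
  have h2v : 2 * v i ≠ 0 := mul_ne_zero two_ne_zero (hv i).ne'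
  have hc0 := (mul_eq_zero.1 ((mul_eq_zero.1 hzero).resolve_right hppos.ne')).resolve_left h2v
  exact ⟨c, hc, sub_eq_zero.1 hc0⟩

end Risk

/-- A convergent solution of an autonomous integral equation with continuous vector field
converges to a zero of the field. -/
lemma eq_zero_of_tendsto_flow {E : Type*} [NormedAddCommGroup E] [NormedSpace ℝ E]
    [CompleteSpace E] {G : E → E} (hG : Continuous G) {Θ : ℝ → E}
    (hΘ : ContinuousOn Θ (Set.Ici 0))
    (hflow : ∀ t : ℝ, 0 ≤ t → Θ t = Θ 0 - ∫ s in Set.Icc (0 : ℝ) t, G (Θ s))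
    {z : E} (hlim : Tendsto Θ atTop (nhds z)) : G z = 0 := by
  have hint : ∀ s t : ℝ, 0 ≤ s → 0 ≤ t →
      IntervalIntegrable (fun r => G (Θ r)) volume s t := fun s t hs ht =>
    ((hG.comp_continuousOn hΘ).mono fun r hr => (le_inf hs ht).trans hr.1).intervalIntegrable
  have hstep : ∀ t : ℝ, 0 ≤ t → ∫ s in t..(t + 1), G (Θ s) = Θ t - Θ (t + 1) := by
    intro t ht
    rw [hflow t ht, hflow (t + 1) (by linarith), integral_Icc_eq_integral_Ioc,
      integral_Icc_eq_integral_Ioc, ← intervalIntegral.integral_of_le ht,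
      ← intervalIntegral.integral_of_le (by linarith : 0 ≤ t + 1),
      ← intervalIntegral.integral_add_adjacent_intervals (hint 0 t le_rfl ht)
        (hint t (t + 1) ht (by linarith))]
    abel
  have hzero : Tendsto (fun t => ∫ s in t..(t + 1), G (Θ s)) atTop (nhds 0) := by
    have h1 : Tendsto (fun t => Θ t - Θ (t + 1)) atTop (nhds (z - z)) :=
      hlim.sub (hlim.comp (tendsto_atTop_add_const_right _ 1 tendsto_id))
    rw [sub_self] at h1
    refine h1.congr' ?_
    filter_upwards [eventually_ge_atTop 0] with t ht using (hstep t ht).symm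
  refine tendsto_nhds_unique ?_ hzero
  rw [Metric.tendsto_atTop]
  intro ε hε
  obtain ⟨T, hT⟩ := Metric.tendsto_atTop.1 ((hG.tendsto z).comp hlim) (ε / 2) (half_pos hε)
  refine ⟨max T 0, fun t ht => ?_⟩
  have hconst : ∫ _ in t..(t + 1), G z = G z := by simp
  have ht0 : 0 ≤ t := (le_max_right _ _).trans ht
  rw [dist_eq_norm, ← hconst, ← intervalIntegral.integral_sub (hint _ _ ht0 (by linarith)) intervalIntegrable_const]
  refine lt_of_le_of_lt
    (intervalIntegral.norm_integral_le_of_norm_le_const (C := ε / 2) fun s hs => ?_) ?_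
  · rw [Set.uIoc_of_le (by linarith)] at hs
    rw [← dist_eq_norm]
    exact (hT s (((le_max_left _ _).trans ht).trans hs.1.le)).le
  · rw [add_sub_cancel_left, abs_one, mul_one]
    exact half_lt_self hε

lemma tendsto_of_tendsto_euclNorm {n : ℕ} {Θ : ℝ → Fin n → ℝ} {z : Fin n → ℝ}
    (hlim : Tendsto (fun t => euclNorm (Θ t - z)) atTop (nhds 0)) :
    Tendsto Θ atTop (nhds z) := by
  rw [tendsto_pi_nhds]
  intro k
  rw [tendsto_iff_norm_sub_tendsto_zero]
  refine squeeze_zero (fun _ => norm_nonneg _) (fun t => ?_) hlim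
  exact Real.abs_le_sqrt (Finset.single_le_sum (f := fun i => ((Θ t - z) i) ^ 2)
    (fun i _ => sq_nonneg _) (Finset.mem_univ k))

lemma actI_nonempty {h : ℕ} {w : Fin h → ℝ} (hw : ∀ i, 0 < w i) {a b : ℝ} (hab : a < b)
    {θ : Fin (h + 1) → ℝ} {i : Fin h} (hi : psiC w θ i ∈ Set.Ioo (a - (w i)⁻¹) b) :
    (actI a b w θ i).Nonempty := by
  have hwi := inv_pos.2 (hw i)
  rw [actI, Set.Ioo_inter_Ioo, Set.nonempty_Ioo, sup_lt_iff, lt_inf_iff, lt_inf_iff]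
  exact ⟨⟨by linarith, hi.2⟩, by linarith [hi.1], hab⟩

/-- If the realization meets the target in each activity interval indexed by `S`, the total weight
of `S` is bounded by the increment of the target plus twice the maximal overlap. -/
lemma sum_le_of_forall_exists_realC_eq {h : ℕ} {v w : Fin h → ℝ} (hv : ∀ i, 0 < v i)
    (hw : ∀ i, 0 < w i) {a b : ℝ} {f : ℝ → ℝ} (hfmono : Monotone f) {θ : Fin (h + 1) → ℝ}
    {S : Finset (Fin h)} (hS : S.Nonempty)
    (hx : ∀ i ∈ S, ∃ x ∈ actI a b w θ i, realC v w θ x = f x) {V : ℝ}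
    (hV : ∀ x ∈ Set.Ioo a b, ∑ i, (actI a b w θ i).indicator (fun _ => v i) x ≤ V) :
    ∑ i ∈ S, v i ≤ f b - f a + 2 * V := by
  choose! x hxmem hxeq using hx
  obtain ⟨j, hj, hmin⟩ := S.exists_min_image x hS
  obtain ⟨k, hk, hmax⟩ := S.exists_max_image x hS
  have hjab : x j ∈ Set.Ioo a b := (hxmem j hj).2
  have hkab : x k ∈ Set.Ioo a b := (hxmem k hk).2
  have hterm : ∀ i, (if i ∈ S then v i else 0) ≤
      (v i * clipFn (w i * x k + θ i.castSucc) - v i * clipFn (w i * x j + θ i.castSucc)) +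
        ((actI a b w θ i).indicator (fun _ => v i) (x j) +
          (actI a b w θ i).indicator (fun _ => v i) (x k)) := by
    intro i
    have hvi := (hv i).le
    have hjk := mul_le_mul_of_nonneg_left (hmin k hk) (hw i).le
    have hclip := mul_le_mul_of_nonneg_left (clipFn_mono
      (show w i * x j + θ i.castSucc ≤ w i * x k + θ i.castSucc by linarith)) hvi
    have hindj := Set.indicator_nonneg (s := actI a b w θ i) (fun _ _ => hvi) (x j)
    have hindk := Set.indicator_nonneg (s := actI a b w θ i) (fun _ _ => hvi) (x k)
    split_ifs with hi
    swap
    · linarith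
    by_cases hmj : x j ∈ actI a b w θ i
    · rw [Set.indicator_of_mem hmj]
      linarith
    by_cases hmk : x k ∈ actI a b w θ i
    · rw [Set.indicator_of_mem hmk]
      linarith
    have hji := mul_le_mul_of_nonneg_left (hmin i hi) (hw i).le
    have hik := mul_le_mul_of_nonneg_left (hmax i hi) (hw i).le
    have hact := ((mem_actI_iff hw).1 (hxmem i hi)).1
    have hleft : w i * x j + θ i.castSucc ≤ 0 := by
      by_contra! hpos
      exact hmj ((mem_actI_iff hw).2 ⟨⟨hpos, by linarith⟩, hjab⟩)
    have hright : 1 ≤ w i * x k + θ i.castSucc := by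
      by_contra! hlt
      exact hmk ((mem_actI_iff hw).2 ⟨⟨by linarith, hlt⟩, hkab⟩)
    rw [clipFn_of_nonpos hleft, clipFn_of_one_le hright]
    linarith
  have hsum := Finset.sum_le_sum fun i (_ : i ∈ Finset.univ) => hterm i
  rw [Finset.sum_add_distrib, Finset.sum_add_distrib, Finset.sum_sub_distrib,
    Finset.sum_ite_mem, Finset.univ_inter] at hsum
  have hj' := hxeq j hj
  have hk' := hxeq k hk
  unfold realC at hj' hk'
  have := hfmono hjab.1.le
  have := hfmono hkab.2.le
  have := hV _ hjab
  have := hV _ hkab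
  linarith

theorem statement_13
    (a b : ℝ) (hab : a < b) (h : ℕ) (hh : 0 < h)
    (v w : Fin h → ℝ) (hv : ∀ i, 0 < v i) (hw : ∀ i, 0 < w i)
    (f p : ℝ → ℝ) (hf : Continuous f) (hp : Continuous p)
    (hpnn : ∀ x : ℝ, 0 ≤ p x) (hsupp : {x : ℝ | 0 < p x} = Set.Ioo a b)
    (hfmono : Monotone f)
    -- `Lip(f) < min_i v_i w_i`
    (K : ℝ) (hK : ∀ i, K < v i * w i)
    (hLipf : ∀ x ∈ Set.Icc a b, ∀ y ∈ Set.Icc a b, |f x - f y| ≤ K * |x - y|)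
    (Θ : ℝ → Fin (h + 1) → ℝ)
    (hcont : ContinuousOn Θ (Set.Ici 0))
    (hGF : ∀ t : ℝ, 0 ≤ t →
      Θ t = Θ 0 - ∫ s in Set.Icc (0 : ℝ) t, gradC a b v w f p (Θ s))
    (ϑ : Fin (h + 1) → ℝ)
    (hlim : Filter.Tendsto (fun t => euclNorm (Θ t - ϑ)) Filter.atTop (nhds 0))
    (V : ℝ)
    (hV : V = sSup ((fun x => ∑ i : Fin h, (actI a b w ϑ i).indicator (fun _ => v i) x) ''
      Set.Ioo a b))
    (hbig : f b - f a + 4 * V <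
      ∑ i : Fin h, (Set.Ioo (a - (w i)⁻¹) b).indicator (fun _ => v i) (psiC w (Θ 0) i)) :
    ∃ i : Fin h, (actI a b w (Θ 0) i).Nonempty ∧ actI a b w ϑ i = ∅ := by
  have hpos : ∀ x ∈ Set.Ioo a b, 0 < p x := fun x hx => by rwa [← hsupp] at hx
  have hcrit : gradC a b v w f p ϑ = 0 :=
    eq_zero_of_tendsto_flow (continuous_gradC hv hw hf hp hpnn) hcont hGF
      (tendsto_of_tendsto_euclNorm hlim)
  have hVle : ∀ x ∈ Set.Ioo a b, ∑ i, (actI a b w ϑ i).indicator (fun _ => v i) x ≤ V := by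
    intro x hx
    rw [hV]
    refine le_csSup ⟨∑ i, v i, ?_⟩ (Set.mem_image_of_mem _ hx)
    rintro _ ⟨y, _, rfl⟩
    exact Finset.sum_le_sum fun i _ => Set.indicator_le_self' (fun _ _ => (hv i).le) y
  have hV0 : 0 ≤ V := by
    obtain ⟨x, hx⟩ := exists_between hab
    exact (Finset.sum_nonneg fun i _ =>
      Set.indicator_nonneg (fun _ _ => (hv i).le) x).trans (hVle x hx)
  by_contra! hcon
  classical
  simp only [Set.indicator_apply] at hbig
  rw [← Finset.sum_filter] at hbig
  have hfab := hfmono hab.le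
  have hSne : (Finset.univ.filter fun i =>
      psiC w (Θ 0) i ∈ Set.Ioo (a - (w i)⁻¹) b).Nonempty := by
    by_contra hempty
    rw [Finset.not_nonempty_iff_eq_empty.1 hempty, Finset.sum_empty] at hbig
    linarith
  have := sum_le_of_forall_exists_realC_eq hv hw hfmono hSne (fun i hi =>
    exists_mem_actI_realC_eq hv hw hf hp hpnn hpos hcrit
      (hcon i (actI_nonempty hw hab (Finset.mem_filter.1 hi).2))) hVle
  linarith
end
end

section
/- Let (Ω, F, P) be a probability space, let X : Ω → (0, ∞) and Y : Ω → (0, ∞) be independent and identically distributed random variables satisfying P(X ≤ x) = (2/π)^{1/2} ∫_0^x exp(−y²/2) dy for all x ∈ (0, ∞). Then (i) for all z ∈ (0, ∞) it holds that P(XY ≤ z) = (2/π) ∫_0^z K_0(y) dy, and (ii) there exists c ∈ (0, ∞) such that for all z ∈ (0, ∞) it holds that P(XY ≤ z) ≤ c z (1 + |ln(z)|). -/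
open MeasureTheory ProbabilityTheory

noncomputable section

/-- The modified Bessel function `K₀(x) = ∫_0^∞ exp(-x cosh w) dw`. -/
def K0 (x : ℝ) : ℝ := ∫ t in Set.Ioi (0 : ℝ), Real.exp (-x * Real.cosh t)

open Set

lemma lintegral_comp_abs (f : ℝ → ENNReal) :
    ∫⁻ x, f |x| = 2 * ∫⁻ x in Ioi (0 : ℝ), f x := by
  have hpos : ∫⁻ x in Ioi (0 : ℝ), f |x| = ∫⁻ x in Ioi (0 : ℝ), f x :=
    setLIntegral_congr_fun measurableSet_Ioi fun x hx => by simp only [abs_of_pos (mem_Ioi.1 hx)]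
  have hneg : ∫⁻ x in Iic (0 : ℝ), f |x| = ∫⁻ x in Ioi (0 : ℝ), f x := by
    have h := lintegral_image_eq_lintegral_abs_deriv_mul (s := Ioi (0 : ℝ)) (f := fun x => -x)
      (f' := fun _ => -1) measurableSet_Ioi (fun x _ => (hasDerivAt_neg x).hasDerivWithinAt)
      neg_injective.injOn (fun x => f |x|)
    rw [image_neg_eq_neg, neg_Ioi, neg_zero] at h
    rw [← setLIntegral_congr Iio_ae_eq_Iic, h, ← hpos]
    simp
  rw [← lintegral_add_compl _ (measurableSet_Iic (a := (0 : ℝ))), compl_Iic, hneg, hpos, two_mul]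

lemma integrableOn_exp_neg_mul_cosh {u : ℝ} (hu : 0 < u) :
    IntegrableOn (fun t => Real.exp (-u * Real.cosh t)) (Ioi 0) := by
  refine (integrableOn_exp_mul_Ioi (neg_lt_zero.2 hu) 0).mono'
    (by fun_prop) (Filter.Eventually.of_forall fun t => ?_)
  rw [Real.norm_of_nonneg (Real.exp_pos _).le, Real.exp_le_exp]
  have h : t ≤ Real.cosh t := by
    rcases le_total 0 t with ht | ht
    · exact (Real.self_le_sinh_iff.2 ht).trans (Real.sinh_lt_cosh t).le
    · exact ht.trans (Real.cosh_pos t).le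
  nlinarith

lemma K0_nonneg (u : ℝ) : 0 ≤ K0 u := integral_nonneg fun _ => (Real.exp_pos _).le

lemma stronglyMeasurable_K0 : StronglyMeasurable K0 := by
  refine StronglyMeasurable.integral_prod_right
    (f := fun x t : ℝ => Real.exp (-x * Real.cosh t)) (Continuous.stronglyMeasurable ?_)
  simp only [Function.uncurry_def]
  fun_prop

lemma K0_le {u : ℝ} (hu : 0 < u) (hu1 : u ≤ 1) : K0 u ≤ 2 - Real.log u := by
  have hlog : 0 ≤ -Real.log u := neg_nonneg.2 (Real.log_nonpos hu.le hu1)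
  have hint := integrableOn_exp_neg_mul_cosh hu
  have hsplit : Ioc 0 (-Real.log u) ∪ Ioi (-Real.log u) = Ioi 0 := Ioc_union_Ioi_eq_Ioi hlog
  rw [← hsplit] at hint
  rw [K0, ← hsplit, setIntegral_union Ioc_disjoint_Ioi_same measurableSet_Ioi
    hint.left_of_union hint.right_of_union]
  have h1 : ∫ t in Ioc 0 (-Real.log u), Real.exp (-u * Real.cosh t) ≤ -Real.log u := by
    calc _ ≤ ∫ t in Ioc 0 (-Real.log u), (1 : ℝ) := by
          refine setIntegral_mono hint.left_of_union (by simp) fun t => ?_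
          exact Real.exp_le_one_iff.2 (by nlinarith [Real.cosh_pos t])
      _ = _ := by simp [hlog]
  have h2 : ∫ t in Ioi (-Real.log u), Real.exp (-u * Real.cosh t) ≤ 2 := by
    have hneg : (-(1 / 2) : ℝ) < 0 := by norm_num
    calc _ ≤ ∫ t in Ioi (-Real.log u), Real.exp (-Real.log u / 2) * Real.exp (-(1 / 2) * t) := by
          refine setIntegral_mono hint.right_of_union
            ((integrableOn_exp_mul_Ioi hneg _).const_mul _) fun t => ?_
          simp only [← Real.exp_add, Real.exp_le_exp]
          have h := Real.add_one_le_exp (t + Real.log u)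
          rw [Real.exp_add, Real.exp_log hu] at h
          rw [Real.cosh_eq]
          nlinarith [Real.exp_pos (-t)]
      _ = 2 := by
          rw [integral_const_mul, integral_exp_mul_Ioi hneg, mul_div_assoc', mul_neg,
            ← Real.exp_add]
          ring_nf
          simp
  linarith

lemma intervalIntegral_K0_le {z : ℝ} (hz : 0 < z) (hz1 : z ≤ 1) :
    ∫ y in (0 : ℝ)..z, K0 y ≤ z * (3 - Real.log z) := by
  have hint : IntervalIntegrable (fun y => 2 - Real.log y) volume 0 z :=
    intervalIntegrable_const.sub intervalIntegral.intervalIntegrable_log'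
  calc _ ≤ ∫ y in (0 : ℝ)..z, (2 - Real.log y) := by
        rw [intervalIntegral.integral_of_le hz.le, intervalIntegral.integral_of_le hz.le]
        refine integral_mono_of_nonneg (Filter.Eventually.of_forall K0_nonneg) hint.1 ?_
        exact (ae_restrict_iff' measurableSet_Ioc).2
          (Filter.Eventually.of_forall fun y hy => K0_le hy.1 (hy.2.trans hz1))
    _ = _ := by
        rw [intervalIntegral.integral_sub intervalIntegrable_const
          intervalIntegral.intervalIntegrable_log', integral_log]
        simp
        ring

/-- The density of the half-normal distribution with respect to Lebesgue measure on `(0, ∞)`. -/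
def halfNormalPDF (x : ℝ) : ENNReal :=
  ENNReal.ofReal (Real.sqrt (2 / Real.pi) * Real.exp (-x ^ 2 / 2))

@[fun_prop]
lemma measurable_halfNormalPDF : Measurable halfNormalPDF := by
  unfold halfNormalPDF
  fun_prop

/-- The half-normal distribution. -/
def halfNormal : Measure ℝ := (volume.restrict (Ioi 0)).withDensity halfNormalPDF

lemma halfNormal_Iic {x : ℝ} (hx : 0 ≤ x) :
    halfNormal (Iic x) = ENNReal.ofReal
      (Real.sqrt (2 / Real.pi) * ∫ y in (0 : ℝ)..x, Real.exp (-y ^ 2 / 2)) := by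
  rw [halfNormal, withDensity_apply _ measurableSet_Iic, Measure.restrict_restrict
    measurableSet_Iic, inter_comm, Ioi_inter_Iic, intervalIntegral.integral_of_le hx,
    ← integral_const_mul, ofReal_integral_eq_lintegral_ofReal]
  · rfl
  · exact (Continuous.integrableOn_Icc (by fun_prop)).mono_set Ioc_subset_Icc_self
  · exact Filter.Eventually.of_forall fun y => by positivity

lemma map_eq_halfNormal {Ω : Type*} [MeasurableSpace Ω] {μ : Measure Ω} [IsProbabilityMeasure μ]
    {X : Ω → ℝ} (hX : Measurable X) (hXpos : ∀ ω, 0 < X ω)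
    (hcdf : ∀ x : ℝ, 0 < x → (μ {ω | X ω ≤ x}).toReal
      = Real.sqrt (2 / Real.pi) * ∫ y in (0 : ℝ)..x, Real.exp (-y ^ 2 / 2)) :
    μ.map X = halfNormal := by
  have := Measure.isProbabilityMeasure_map (μ := μ) hX.aemeasurable
  refine Measure.ext_of_Iic _ _ fun x => ?_
  rw [Measure.map_apply hX measurableSet_Iic]
  rcases lt_or_ge 0 x with hx | hx
  · rw [halfNormal_Iic hx.le, ← hcdf x hx, ENNReal.ofReal_toReal (measure_ne_top _ _)]
    rfl
  · have h1 : X ⁻¹' Iic x = ∅ := by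
      ext ω
      simpa using hx.trans_lt (hXpos ω)
    have h2 : Iic x ∩ Ioi 0 = ∅ := by
      rw [inter_comm, Ioi_inter_Iic, Ioc_eq_empty (not_lt.2 hx)]
    rw [h1, measure_empty, halfNormal, withDensity_apply _ measurableSet_Iic,
      Measure.restrict_restrict measurableSet_Iic, h2]
    simp

lemma halfNormal_mul_le {y : ℝ} (hy : 0 < y) (z : ℝ) :
    halfNormal {x | x * y ≤ z}
      = ∫⁻ u in Ioc 0 z, ENNReal.ofReal y⁻¹ * halfNormalPDF (u / y) := by
  have h := lintegral_image_eq_lintegral_abs_deriv_mul (s := Ioc 0 z) (f := fun u => u / y)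
    (f' := fun _ => y⁻¹) measurableSet_Ioc
    (fun x _ => by simpa using ((hasDerivAt_id x).div_const y).hasDerivWithinAt)
    (fun a _ b _ hab => (div_left_inj' hy.ne').1 hab) halfNormalPDF
  have himage : (fun u => u / y) '' Ioc 0 z = {x | x * y ≤ z} ∩ Ioi 0 := by
    ext x
    simp only [mem_image, mem_Ioc, mem_inter_iff, mem_ofPred_eq, mem_Ioi]
    constructor
    · rintro ⟨u, ⟨hu, huz⟩, rfl⟩
      exact ⟨by rwa [div_mul_cancel₀ _ hy.ne'], by positivity⟩
    · rintro ⟨hxz, hx⟩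
      exact ⟨x * y, ⟨by positivity, hxz⟩, by field_simp⟩
  have hmeas : MeasurableSet {x : ℝ | x * y ≤ z} :=
    measurableSet_le (by fun_prop) (by fun_prop)
  rw [abs_of_pos (inv_pos.2 hy), himage] at h
  rw [halfNormal, withDensity_apply _ hmeas, Measure.restrict_restrict hmeas, h]

lemma lintegral_halfNormalPDF_mul {u : ℝ} (hu : 0 < u) :
    ∫⁻ y in Ioi 0, halfNormalPDF y * (ENNReal.ofReal y⁻¹ * halfNormalPDF (u / y))
      = ENNReal.ofReal (2 / Real.pi * K0 u) := by
  have hsu : 0 < √u := Real.sqrt_pos.2 hu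
  have himage : (fun s => √u * Real.exp (s / 2)) '' univ = Ioi 0 := by
    ext y
    simp only [image_univ, mem_range, mem_Ioi]
    constructor
    · rintro ⟨s, rfl⟩
      positivity
    · intro hy
      refine ⟨2 * Real.log (y / √u), ?_⟩
      rw [mul_div_cancel_left₀ _ two_ne_zero, Real.exp_log (by positivity)]
      field_simp
  have h := lintegral_image_eq_lintegral_abs_deriv_mul (s := univ)
    (f := fun s => √u * Real.exp (s / 2)) (f' := fun s => √u * (Real.exp (s / 2) * (1 / 2)))
    MeasurableSet.univ
    (fun x _ => ((((hasDerivAt_id x).div_const 2).exp).const_mul √u).hasDerivWithinAt)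
    (fun a _ b _ hab => by
      have := Real.exp_injective (mul_left_cancel₀ hsu.ne' hab)
      linarith)
    (fun y => halfNormalPDF y * (ENNReal.ofReal y⁻¹ * halfNormalPDF (u / y)))
  rw [himage] at h
  have hpt (s : ℝ) : ENNReal.ofReal |√u * (Real.exp (s / 2) * (1 / 2))| *
      (halfNormalPDF (√u * Real.exp (s / 2)) * (ENNReal.ofReal (√u * Real.exp (s / 2))⁻¹ *
        halfNormalPDF (u / (√u * Real.exp (s / 2)))))
      = ENNReal.ofReal (1 / Real.pi * Real.exp (-u * Real.cosh |s|)) := by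
    unfold halfNormalPDF
    rw [← ENNReal.ofReal_mul (by positivity), ← ENNReal.ofReal_mul (by positivity),
      ← ENNReal.ofReal_mul (by positivity), abs_of_pos (by positivity), Real.cosh_abs]
    congr 1
    have hdiv : u / (√u * Real.exp (s / 2)) = √u * Real.exp (-(s / 2)) := by
      rw [Real.exp_neg]
      field_simp
      exact (Real.sq_sqrt hu.le).symm
    have hexp : -u * Real.cosh s = -(√u * Real.exp (s / 2)) ^ 2 / 2
        + -(√u * Real.exp (-(s / 2))) ^ 2 / 2 := by
      rw [mul_pow, mul_pow, Real.sq_sqrt hu.le, ← Real.exp_nat_mul, ← Real.exp_nat_mul,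
        Real.cosh_eq]
      push_cast
      ring_nf
    have hpi : √(2 / Real.pi) * √(2 / Real.pi) = 2 / Real.pi :=
      Real.mul_self_sqrt (by positivity)
    rw [hdiv, hexp, Real.exp_add]
    generalize Real.exp (-(√u * Real.exp (s / 2)) ^ 2 / 2) = a
    generalize Real.exp (-(√u * Real.exp (-(s / 2))) ^ 2 / 2) = b
    have hne : √u * Real.exp (s / 2) ≠ 0 := by positivity
    calc _ = (√(2 / Real.pi) * √(2 / Real.pi)) * (a * b) * (1 / 2)
          * ((√u * Real.exp (s / 2)) * (√u * Real.exp (s / 2))⁻¹) := by ring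
      _ = _ := by
        rw [hpi, mul_inv_cancel₀ hne]
        ring
  rw [h, setLIntegral_univ, lintegral_congr hpt,
    lintegral_comp_abs (fun t => ENNReal.ofReal (1 / Real.pi * Real.exp (-u * Real.cosh t))),
    ← ofReal_integral_eq_lintegral_ofReal ((integrableOn_exp_neg_mul_cosh hu).const_mul _)
      (Filter.Eventually.of_forall fun t => by positivity), integral_const_mul, ← K0,
    ← ENNReal.ofReal_ofNat, ← ENNReal.ofReal_mul (by norm_num)]
  congr 1
  ring

lemma halfNormal_prod_mul_le (z : ℝ) :
    (halfNormal.prod halfNormal) {p : ℝ × ℝ | p.1 * p.2 ≤ z}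
      = ∫⁻ u in Ioc 0 z, ENNReal.ofReal (2 / Real.pi * K0 u) := by
  have : SFinite halfNormal := by unfold halfNormal; infer_instance
  have hS : MeasurableSet {p : ℝ × ℝ | p.1 * p.2 ≤ z} :=
    measurableSet_le (by fun_prop) (by fun_prop)
  rw [Measure.prod_apply_symm hS]
  calc _ = ∫⁻ y in Ioi 0, halfNormalPDF y * halfNormal {x | x * y ≤ z} := by
        conv_lhs => rw [halfNormal]
        rw [lintegral_withDensity_eq_lintegral_mul _ measurable_halfNormalPDF]
        · rfl
        · exact measurable_measure_prodMk_right hS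
    _ = ∫⁻ y in Ioi 0, ∫⁻ u in Ioc 0 z,
          halfNormalPDF y * (ENNReal.ofReal y⁻¹ * halfNormalPDF (u / y)) := by
        refine setLIntegral_congr_fun measurableSet_Ioi fun y hy => ?_
        rw [halfNormal_mul_le hy, ← lintegral_const_mul _ (by fun_prop)]
    _ = ∫⁻ u in Ioc 0 z, ∫⁻ y in Ioi 0,
          halfNormalPDF y * (ENNReal.ofReal y⁻¹ * halfNormalPDF (u / y)) :=
        lintegral_lintegral_swap (by
          apply Measurable.aemeasurable
          simp only [Function.uncurry_def]
          fun_prop)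
    _ = _ := setLIntegral_congr_fun measurableSet_Ioc fun u hu => lintegral_halfNormalPDF_mul hu.1

theorem statement_15
    {Ω : Type*} [MeasureSpace Ω] [IsProbabilityMeasure (ℙ : Measure Ω)]
    (X Y : Ω → ℝ) (hX : Measurable X) (hY : Measurable Y)
    (hXpos : ∀ ω, 0 < X ω) (hYpos : ∀ ω, 0 < Y ω)
    (hindep : IndepFun X Y ℙ)
    (hid : Measure.map X ℙ = Measure.map Y ℙ)
    (hcdf : ∀ x : ℝ, 0 < x →
      (ℙ {ω | X ω ≤ x}).toReal
        = Real.sqrt (2 / Real.pi) * ∫ y in (0 : ℝ)..x, Real.exp (-y ^ 2 / 2)) :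
    (∀ z : ℝ, 0 < z →
      (ℙ {ω | X ω * Y ω ≤ z}).toReal = (2 / Real.pi) * ∫ y in (0 : ℝ)..z, K0 y) ∧
    ∃ c : ℝ, 0 < c ∧ ∀ z : ℝ, 0 < z →
      (ℙ {ω | X ω * Y ω ≤ z}).toReal ≤ c * z * (1 + |Real.log z|) := by
  have hXlaw := map_eq_halfNormal hX hXpos hcdf
  have hprob (z : ℝ) (hz : 0 < z) :
      (ℙ {ω | X ω * Y ω ≤ z}).toReal = (2 / Real.pi) * ∫ y in (0 : ℝ)..z, K0 y := by
    have hS : MeasurableSet {p : ℝ × ℝ | p.1 * p.2 ≤ z} :=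
      measurableSet_le (by fun_prop) (by fun_prop)
    have hmap := hindep.map_prod_eq_prod_map_map hX.aemeasurable hY.aemeasurable
    rw [← hid, hXlaw] at hmap
    have h := halfNormal_prod_mul_le z
    rw [← hmap, Measure.map_apply (hX.prodMk hY) hS] at h
    rw [intervalIntegral.integral_of_le hz.le, ← integral_const_mul,
      integral_eq_lintegral_of_nonneg_ae
        (Filter.Eventually.of_forall fun u => mul_nonneg (by positivity) (K0_nonneg u))
        (stronglyMeasurable_K0.const_mul _).aestronglyMeasurable, ← h]
    rfl
  refine ⟨hprob, 3, by norm_num, fun z hz => ?_⟩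
  rcases le_total z 1 with hz1 | hz1
  · have hlog : Real.log z ≤ 0 := Real.log_nonpos hz.le hz1
    have hpi : 2 / Real.pi ≤ 1 := (div_le_one Real.pi_pos).2 Real.two_le_pi
    rw [hprob z hz, abs_of_nonpos hlog]
    calc _ ≤ 1 * ∫ y in (0 : ℝ)..z, K0 y := by
          gcongr
          exact intervalIntegral.integral_nonneg hz.le fun y _ => K0_nonneg y
      _ ≤ z * (3 - Real.log z) := by
          rw [one_mul]
          exact intervalIntegral_K0_le hz hz1
      _ ≤ _ := by nlinarith
  · calc (ℙ {ω | X ω * Y ω ≤ z}).toReal ≤ 1 := measureReal_le_one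
      _ ≤ _ := by nlinarith [mul_nonneg hz.le (abs_nonneg (Real.log z))]
end
end

section
/- Let (Ω, F, P) be a probability space, let N ∈ ℕ, α ∈ ℝ, ε ∈ (0, 1), δ ∈ (0, ε), let X_1, …, X_N : Ω → (0, ∞) be random variables, and assume for all i ∈ {1, …, N} and x ∈ (0, ∞) that P(N^α X_i ≤ x) = (2/π)^{1/2} ∫_0^x exp(−y²/2) dy. Then P(max{X_1, …, X_N} ≥ N^{−α+ε}) ≤ (ε − δ)^{−1} N^{−δ}. -/
open MeasureTheory ProbabilityTheory

noncomputable section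

lemma hasDerivAt_exp_neg_sq_div_two (x : ℝ) :
    HasDerivAt (fun y : ℝ => Real.exp (-y ^ 2 / 2)) (-x * Real.exp (-x ^ 2 / 2)) x := by
  have h : HasDerivAt (fun y : ℝ => -y ^ 2 / 2) (-x) x := by
    refine ((hasDerivAt_pow 2 x).neg.div_const 2).congr_deriv ?_
    push_cast
    ring
  convert h.exp using 1
  ring

lemma tendsto_integral_exp_neg_sq_div_two :
    Filter.Tendsto (fun x : ℝ => ∫ y in (0 : ℝ)..x, Real.exp (-y ^ 2 / 2)) Filter.atTop
      (nhds (Real.sqrt (2 * Real.pi) / 2)) := by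
  have hfun : (fun y : ℝ => Real.exp (-y ^ 2 / 2)) = fun y => Real.exp (-(1 / 2) * y ^ 2) := by
    funext y
    ring_nf
  have hint : ∫ y in Set.Ioi (0 : ℝ), Real.exp (-y ^ 2 / 2) = Real.sqrt (2 * Real.pi) / 2 := by
    rw [hfun, integral_gaussian_Ioi]
    congr 2
    ring
  rw [← hint]
  refine intervalIntegral_tendsto_integral_Ioi 0 ?_ Filter.tendsto_id
  rw [hfun]
  exact (integrable_exp_neg_mul_sq (by norm_num)).integrableOn

/-- Mills' upper bound for the Gaussian tail. -/
lemma sqrt_two_mul_pi_div_two_le_integral_add {x : ℝ} (hx : 0 < x) :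
    Real.sqrt (2 * Real.pi) / 2
      ≤ (∫ y in (0 : ℝ)..x, Real.exp (-y ^ 2 / 2)) + Real.exp (-x ^ 2 / 2) / x := by
  have hcont : Continuous fun y : ℝ => Real.exp (-y ^ 2 / 2) := by fun_prop
  set g : ℝ → ℝ := fun x => (∫ y in (0 : ℝ)..x, Real.exp (-y ^ 2 / 2)) + Real.exp (-x ^ 2 / 2) / x
    with hg
  have hder : ∀ z : ℝ, 0 < z → HasDerivAt g (-(Real.exp (-z ^ 2 / 2) / z ^ 2)) z := by
    intro z hz
    have h1 := intervalIntegral.integral_hasDerivAt_right (hcont.intervalIntegrable 0 z)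
      (hcont.stronglyMeasurableAtFilter _ _) hcont.continuousAt
    refine (h1.add ((hasDerivAt_exp_neg_sq_div_two z).div (hasDerivAt_id' z) hz.ne')).congr_deriv ?_
    field_simp
    ring
  have hanti : AntitoneOn g (Set.Ici x) := by
    refine antitoneOn_of_deriv_nonpos (convex_Ici x)
      (fun z hz => (hder z (hx.trans_le hz)).continuousAt.continuousWithinAt)
      (fun z hz => ?_) (fun z hz => ?_)
    · rw [interior_Ici] at hz
      exact (hder z (hx.trans hz)).differentiableAt.differentiableWithinAt
    · rw [interior_Ici] at hz
      rw [(hder z (hx.trans hz)).deriv]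
      exact neg_nonpos.2 (by positivity)
  refine le_of_tendsto tendsto_integral_exp_neg_sq_div_two ?_
  filter_upwards [Filter.eventually_ge_atTop x] with b hb
  have hbpos : 0 < b := hx.trans_le hb
  have h := hanti Set.self_mem_Ici hb hb
  have h' : 0 ≤ Real.exp (-b ^ 2 / 2) / b := by positivity
  simp only [hg] at h
  linarith

lemma one_sub_halfNormal_cdf_le {x : ℝ} (hx : 0 < x) :
    1 - Real.sqrt (2 / Real.pi) * ∫ y in (0 : ℝ)..x, Real.exp (-y ^ 2 / 2)
      ≤ Real.exp (-x ^ 2 / 2) / x := by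
  have hprod : Real.sqrt (2 / Real.pi) * (Real.sqrt (2 * Real.pi) / 2) = 1 := by
    rw [← mul_div_assoc, ← Real.sqrt_mul (by positivity)]
    have : 2 / Real.pi * (2 * Real.pi) = 2 ^ 2 := by
      field_simp
    rw [this, Real.sqrt_sq (by norm_num)]
    norm_num
  have hle : Real.sqrt (2 / Real.pi) ≤ 1 := by
    rw [Real.sqrt_le_one, div_le_one Real.pi_pos]
    exact Real.two_le_pi
  have h1 := mul_le_mul_of_nonneg_left (sqrt_two_mul_pi_div_two_le_integral_add hx)
    (Real.sqrt_nonneg (2 / Real.pi))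
  have h2 := mul_le_mul_of_nonneg_right hle
    (show 0 ≤ Real.exp (-x ^ 2 / 2) / x by positivity)
  rw [hprod, mul_add] at h1
  linarith

/-- Upper tail bound for a random variable with the half-normal distribution. -/
lemma measureReal_ge_le_of_halfNormal {Ω : Type*} [MeasurableSpace Ω] {μ : Measure Ω}
    [IsProbabilityMeasure μ] {Y : Ω → ℝ} (hY : Measurable Y)
    (hcdf : ∀ x : ℝ, 0 < x → μ.real {ω | Y ω ≤ x}
      = Real.sqrt (2 / Real.pi) * ∫ y in (0 : ℝ)..x, Real.exp (-y ^ 2 / 2))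
    {t : ℝ} (ht : 0 < t) :
    μ.real {ω | t ≤ Y ω} ≤ Real.exp (-t ^ 2 / 2) / t := by
  have hlim : Filter.Tendsto (fun x : ℝ => Real.exp (-x ^ 2 / 2) / x) (nhdsWithin t (Set.Iio t))
      (nhds (Real.exp (-t ^ 2 / 2) / t)) := by
    have h : ContinuousAt (fun x : ℝ => Real.exp (-x ^ 2 / 2) / x) t :=
      ContinuousAt.div (by fun_prop) continuousAt_id ht.ne'
    exact h.tendsto.mono_left nhdsWithin_le_nhds
  refine ge_of_tendsto hlim ?_
  filter_upwards [Ioo_mem_nhdsLT ht] with x hx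
  have hcompl := probReal_compl_eq_one_sub (μ := μ) (measurableSet_le hY (measurable_const (a := x)))
  rw [hcdf x hx.1] at hcompl
  calc μ.real {ω | t ≤ Y ω} ≤ μ.real {ω | Y ω ≤ x}ᶜ :=
        measureReal_mono fun ω hω => not_le.2 (hx.2.trans_le hω)
    _ ≤ Real.exp (-x ^ 2 / 2) / x := hcompl.trans_le (one_sub_halfNormal_cdf_le hx.1)

lemma two_mul_le_exp_self (u : ℝ) : 2 * u ≤ Real.exp u := by
  by_cases hu : 0 ≤ u
  · have h : Real.exp u = Real.exp (u / 2) ^ 2 := by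
      rw [← Real.exp_nat_mul]
      ring_nf
    rw [h]
    nlinarith [Real.add_one_le_exp (u / 2), sq_nonneg (u / 2 - 1)]
  · linarith [Real.exp_pos u]

lemma mul_exp_neg_sq_rpow_div_rpow_le {r ε δ : ℝ} (hr : 1 ≤ r) (hε : 0 < ε) (hδε : δ < ε)
    (hs1 : ε - δ ≤ 1)    (h : 1 < (ε - δ) * r ^ δ) :
    r * (Real.exp (-(r ^ ε) ^ 2 / 2) / r ^ ε) ≤ (ε - δ)⁻¹ * r ^ (-δ) := by
  have hr0 : 0 < r := by linarith
  have hs : 0 < ε - δ := sub_pos.2 hδε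
  have ht : 1 ≤ r ^ ε := Real.one_le_rpow hr hε.le
  have hδpos : 0 < r ^ δ := Real.rpow_pos_of_pos hr0 δ
  have hL : 0 ≤ Real.log r := Real.log_nonneg hr
  have hsplit : r ^ ε = r ^ δ * Real.exp ((ε - δ) * Real.log r) := by
    rw [Real.rpow_def_of_pos hr0, Real.rpow_def_of_pos hr0, ← Real.exp_add]
    ring_nf
  set t := r ^ ε
  set a := r ^ δ
  have hlog : 2 * Real.log r ≤ t := by
    have h1 := mul_le_mul_of_nonneg_left (two_mul_le_exp_self ((ε - δ) * Real.log r)) hδpos.le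
    rw [← hsplit] at h1
    nlinarith [mul_le_mul_of_nonneg_left h.le hL]
  have hrexp : r ≤ Real.exp (t ^ 2 / 2) := by
    rw [← Real.log_le_iff_le_exp hr0]
    nlinarith
  have hsa : (ε - δ) * a ≤ t := by
    rw [hsplit, mul_comm]
    gcongr
    exact hs1.trans (Real.one_le_exp (by positivity))
  have hcancel : Real.exp (t ^ 2 / 2) * Real.exp (-t ^ 2 / 2) = 1 := by
    rw [← Real.exp_add, neg_div, add_neg_cancel, Real.exp_zero]
  calc r * (Real.exp (-t ^ 2 / 2) / t)
      ≤ Real.exp (t ^ 2 / 2) * (Real.exp (-t ^ 2 / 2) / t) := by gcongr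
    _ = t⁻¹ := by rw [← mul_div_assoc, hcancel, one_div]
    _ ≤ ((ε - δ) * a)⁻¹ := by gcongr
    _ = (ε - δ)⁻¹ * r ^ (-δ) := by rw [mul_inv, Real.rpow_neg hr0.le]

theorem statement_16
    {Ω : Type*} [MeasureSpace Ω] [IsProbabilityMeasure (ℙ : Measure Ω)]
    (N : ℕ) (hN : 0 < N) (α ε δ : ℝ)
    (hε : ε ∈ Set.Ioo (0 : ℝ) 1) (hδ : δ ∈ Set.Ioo (0 : ℝ) ε)
    (X : Fin N → Ω → ℝ) (hXm : ∀ i, Measurable (X i)) (hXpos : ∀ i ω, 0 < X i ω)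
    (hcdf : ∀ i : Fin N, ∀ x : ℝ, 0 < x →
      (ℙ {ω | (N : ℝ) ^ α * X i ω ≤ x}).toReal
        = Real.sqrt (2 / Real.pi) * ∫ y in (0 : ℝ)..x, Real.exp (-y ^ 2 / 2)) :
    (ℙ {ω | (N : ℝ) ^ (-α + ε) ≤ ⨆ i, X i ω}).toReal ≤ (ε - δ)⁻¹ * (N : ℝ) ^ (-δ) := by
  have hN1 : (1 : ℝ) ≤ N := by exact_mod_cast hN
  have hN0 : (0 : ℝ) < N := by linarith
  have hs : 0 < ε - δ := sub_pos.2 hδ.2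
  rcases le_or_gt ((ε - δ) * (N : ℝ) ^ δ) 1 with h | h
  · refine (measureReal_le_one (μ := (ℙ : Measure Ω))).trans ?_
    rw [Real.rpow_neg hN0.le, ← mul_inv]
    exact (one_le_inv₀ (by positivity)).2 h
  have : Nonempty (Fin N) := ⟨⟨0, hN⟩⟩
  have hsub : {ω | (N : ℝ) ^ (-α + ε) ≤ ⨆ i, X i ω}
      ⊆ ⋃ i, {ω | (N : ℝ) ^ ε ≤ (N : ℝ) ^ α * X i ω} := by
    intro ω hω
    obtain ⟨i, hi⟩ := exists_eq_ciSup_of_finite (f := fun i => X i ω)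
    rw [Set.mem_ofPred_eq, ← hi] at hω
    refine Set.mem_iUnion.2 ⟨i, ?_⟩
    calc (N : ℝ) ^ ε = (N : ℝ) ^ α * (N : ℝ) ^ (-α + ε) := by
          rw [← Real.rpow_add hN0]
          ring_nf
      _ ≤ (N : ℝ) ^ α * X i ω := by gcongr
  calc (ℙ : Measure Ω).real {ω | (N : ℝ) ^ (-α + ε) ≤ ⨆ i, X i ω}
      ≤ (ℙ : Measure Ω).real (⋃ i, {ω | (N : ℝ) ^ ε ≤ (N : ℝ) ^ α * X i ω}) :=
        measureReal_mono hsub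
    _ ≤ ∑ i, (ℙ : Measure Ω).real {ω | (N : ℝ) ^ ε ≤ (N : ℝ) ^ α * X i ω} :=
        measureReal_iUnion_fintype_le _
    _ ≤ ∑ _i : Fin N, Real.exp (-((N : ℝ) ^ ε) ^ 2 / 2) / (N : ℝ) ^ ε :=
        Finset.sum_le_sum fun i _ => measureReal_ge_le_of_halfNormal ((hXm i).const_mul _)
          (hcdf i) (by positivity)
    _ = N * (Real.exp (-((N : ℝ) ^ ε) ^ 2 / 2) / (N : ℝ) ^ ε) := by simp
    _ ≤ (ε - δ)⁻¹ * (N : ℝ) ^ (-δ) := mul_exp_neg_sq_rpow_div_rpow_le hN1 hε.1 hδ.2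
        (by linarith [hε.2, hδ.1]) h
end
end

section
/- Let a ∈ ℝ, b ∈ (a, ∞), let f ∈ C¹([a, b], ℝ) and p ∈ C([a, b], ℝ) satisfy for all x ∈ [a, b] that f′(x) > 0 ≤ p(x) and ∫_a^b |p(y)| dy > 0, assume that f is strictly convex, let g : [a, b] → ℝ be affine linear, and assume ∫_a^b (f(x) − g(x)) p(x) dx = 0. Then the set {x ∈ {a, b} : g(x) < f(x)} is nonempty, and with λ = max_{x ∈ {y ∈ {a,b} : g(y) < f(y)}} |f(x) − g(x)| it holds that ∫_a^b (f(x) − g(x))² p(x) dx ≤ λ (λ + sup_{x ∈ [a,b]} f′(x)) (sup_{x ∈ [a,b]} p(x)) (b − a). -/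
open MeasureTheory

noncomputable section

/-- A convex function that is at most `l` at the endpoints and `-M ≤ 0` at `m` can be positive only
close to the endpoints. -/
lemma ConvexOn.mem_endpoint_intervals_of_pos {a b m l M x : ℝ} {h : ℝ → ℝ}
    (hc : ConvexOn ℝ (Set.Icc a b) h) (hm : m ∈ Set.Icc a b) (hM : 0 ≤ M) (hl : 0 < l)
    (hhm : h m = -M) (ha : h a ≤ l) (hb : h b ≤ l) (hx : x ∈ Set.Icc a b) (hpos : 0 < h x) :
    x ∈ Set.Icc a (a + l / (l + M) * (m - a)) ∪ Set.Icc (b - l / (l + M) * (b - m)) b := by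
  have hlM : 0 < l + M := by linarith
  have hab : a ≤ b := hm.1.trans hm.2
  have hne : x ≠ m := by
    rintro rfl
    linarith
  rcases lt_or_gt_of_ne hne with hlt | hlt
  · left
    refine ⟨hx.1, ?_⟩
    have h1 : 0 < m - a := by linarith [hx.1]
    have key := hc.2 (Set.left_mem_Icc.2 hab) hm
      (div_nonneg (by linarith) h1.le : 0 ≤ (m - x) / (m - a))
      (div_nonneg (by linarith [hx.1]) h1.le : 0 ≤ (x - a) / (m - a))
      (by field_simp; ring)
    have hx' : ((m - x) / (m - a)) • a + ((x - a) / (m - a)) • m = x := by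
      simp only [smul_eq_mul]
      field_simp
      ring
    rw [hx', hhm] at key
    simp only [smul_eq_mul] at key
    have h2 : (m - x) / (m - a) * h a ≤ (m - x) / (m - a) * l :=
      mul_le_mul_of_nonneg_left ha (div_nonneg (by linarith) h1.le)
    have h3 : 0 < (m - x) / (m - a) * l + (x - a) / (m - a) * -M := by linarith
    have h4 : (m - x) / (m - a) * l + (x - a) / (m - a) * -M
        = ((m - x) * l - (x - a) * M) / (m - a) := by
      ring
    rw [h4, div_pos_iff_of_pos_right h1] at h3
    rw [← sub_le_iff_le_add', div_mul_eq_mul_div, le_div_iff₀ hlM]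
    linarith
  · right
    refine ⟨?_, hx.2⟩
    have h1 : 0 < b - m := by linarith [hx.2]
    have key := hc.2 hm (Set.right_mem_Icc.2 hab)
      (div_nonneg (by linarith [hx.2]) h1.le : 0 ≤ (b - x) / (b - m))
      (div_nonneg (by linarith) h1.le : 0 ≤ (x - m) / (b - m))
      (by field_simp; ring)
    have hx' : ((b - x) / (b - m)) • m + ((x - m) / (b - m)) • b = x := by
      simp only [smul_eq_mul]
      field_simp
      ring
    rw [hx', hhm] at key
    simp only [smul_eq_mul] at key
    have h2 : (x - m) / (b - m) * h b ≤ (x - m) / (b - m) * l :=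
      mul_le_mul_of_nonneg_left hb (div_nonneg (by linarith) h1.le)
    have h3 : 0 < (b - x) / (b - m) * -M + (x - m) / (b - m) * l := by linarith
    have h4 : (b - x) / (b - m) * -M + (x - m) / (b - m) * l
        = ((x - m) * l - (b - x) * M) / (b - m) := by
      ring
    rw [h4, div_pos_iff_of_pos_right h1] at h3
    rw [sub_le_comm, div_mul_eq_mul_div, le_div_iff₀ hlM]
    linarith

lemma ConvexOn.le_of_endpoints_le {a b l x : ℝ} {h : ℝ → ℝ} (hc : ConvexOn ℝ (Set.Icc a b) h)
    (ha : h a ≤ l) (hb : h b ≤ l) (hx : x ∈ Set.Icc a b) : h x ≤ l := by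
  have hab : a ≤ b := hx.1.trans hx.2
  exact (hc.le_max_of_mem_Icc (Set.left_mem_Icc.2 hab) (Set.right_mem_Icc.2 hab) hx).trans
    (max_le ha hb)

/-- A convex function on `[a, b]` that is orthogonal to a weight `p` with values in `[0, P]` and at
most `l` at the endpoints has weighted square integral at most `l² P (b - a)`. -/
lemma ConvexOn.setIntegral_sq_mul_le {a b l P : ℝ} {h p : ℝ → ℝ} (hab : a ≤ b)
    (hc : ConvexOn ℝ (Set.Icc a b) h) (hcont : ContinuousOn h (Set.Icc a b))
    (hp : ContinuousOn p (Set.Icc a b)) (hpnn : ∀ x ∈ Set.Icc a b, 0 ≤ p x)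
    (hpP : ∀ x ∈ Set.Icc a b, p x ≤ P) (hpint : 0 < ∫ x in Set.Icc a b, p x)
    (horth : ∫ x in Set.Icc a b, h x * p x = 0) (hl : 0 < l) (ha : h a ≤ l) (hb : h b ≤ l) :
    ∫ x in Set.Icc a b, h x ^ 2 * p x ≤ l ^ 2 * P * (b - a) := by
  have hP : 0 ≤ P :=
    (hpnn a (Set.left_mem_Icc.2 hab)).trans (hpP a (Set.left_mem_Icc.2 hab))
  have int_hp : IntegrableOn (fun x => h x * p x) (Set.Icc a b) :=
    (hcont.mul hp).integrableOn_Icc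
  obtain ⟨m, hm, hmin⟩ := isCompact_Icc.exists_isMinOn (Set.nonempty_Icc.2 hab) hcont
  obtain ⟨M, hhm⟩ : ∃ M, h m = -M := ⟨-h m, by ring⟩
  have hmin' : ∀ x ∈ Set.Icc a b, -M ≤ h x := fun x hx => hhm ▸ hmin hx
  have hM : 0 ≤ M := by
    by_contra hM
    have h1 : ∫ x in Set.Icc a b, -M * p x ≤ ∫ x in Set.Icc a b, h x * p x :=
      setIntegral_mono_on (hp.integrableOn_Icc.const_mul _) int_hp measurableSet_Icc
        fun x hx => mul_le_mul_of_nonneg_right (hmin' x hx) (hpnn x hx)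
    rw [horth, integral_const_mul] at h1
    nlinarith
  have hlM : 0 < l + M := by linarith
  have int_pos : IntegrableOn (fun x => max (h x) 0 * p x) (Set.Icc a b) :=
    ((hcont.sup continuousOn_const).mul hp).integrableOn_Icc
  have h1 : ∫ x in Set.Icc a b, h x ^ 2 * p x ≤
      (l + M) * ∫ x in Set.Icc a b, max (h x) 0 * p x := by
    calc ∫ x in Set.Icc a b, h x ^ 2 * p x
        ≤ ∫ x in Set.Icc a b, ((l + M) * (max (h x) 0 * p x) - M * (h x * p x)) := by
          refine setIntegral_mono_on ((hcont.pow 2).mul hp).integrableOn_Icc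
            ((int_pos.const_mul _).sub (int_hp.const_mul _)) measurableSet_Icc fun x hx => ?_
          have hle := hc.le_of_endpoints_le ha hb hx
          have hge := hmin' x hx
          have hsq : h x ^ 2 ≤ (l + M) * max (h x) 0 - M * h x := by
            rcases le_total 0 (h x) with h0 | h0
            · rw [max_eq_left h0]
              nlinarith
            · rw [max_eq_right h0]
              nlinarith
          calc h x ^ 2 * p x ≤ ((l + M) * max (h x) 0 - M * h x) * p x :=
                mul_le_mul_of_nonneg_right hsq (hpnn x hx)
            _ = _ := by ring
      _ = _ := by
          rw [integral_sub (int_pos.const_mul _) (int_hp.const_mul _), integral_const_mul,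
            integral_const_mul, horth, mul_zero, sub_zero]
  set s := l / (l + M) with hs
  have hs0 : 0 ≤ s := by positivity
  set S := Set.Icc a (a + s * (m - a)) ∪ Set.Icc (b - s * (b - m)) b with hS
  have hSm : MeasurableSet S := measurableSet_Icc.union measurableSet_Icc
  have hvol : volume.real S ≤ s * (b - a) := by
    refine (measureReal_union_le _ _).trans ?_
    rw [Real.volume_real_Icc_of_le (by nlinarith [hm.1]),
      Real.volume_real_Icc_of_le (by nlinarith [hm.2])]
    linarith
  have hfin : volume S ≠ ⊤ :=
    ((measure_union_le _ _).trans_lt (ENNReal.add_lt_top.2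
      ⟨measure_Icc_lt_top, measure_Icc_lt_top⟩)).ne
  have int_ind : Integrable (S.indicator fun _ => l * P) :=
    (integrable_indicator_iff hSm).2 (integrableOn_const hfin)
  have h2 : ∫ x in Set.Icc a b, max (h x) 0 * p x ≤ s * (b - a) * (l * P) := by
    calc ∫ x in Set.Icc a b, max (h x) 0 * p x
        ≤ ∫ x in Set.Icc a b, S.indicator (fun _ => l * P) x := by
          refine setIntegral_mono_on int_pos int_ind.integrableOn measurableSet_Icc fun x hx => ?_
          rcases le_or_gt (h x) 0 with h0 | h0
          · rw [max_eq_right h0, zero_mul]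
            exact Set.indicator_nonneg (fun _ _ => by positivity) x
          · rw [max_eq_left h0.le, Set.indicator_of_mem
              (hc.mem_endpoint_intervals_of_pos hm hM hl hhm ha hb hx h0)]
            exact mul_le_mul (hc.le_of_endpoints_le ha hb hx) (hpP x hx) (hpnn x hx) hl.le
      _ ≤ ∫ x, S.indicator (fun _ => l * P) x :=
          setIntegral_le_integral int_ind
            (.of_forall fun x => Set.indicator_nonneg (fun _ _ => by positivity) x)
      _ = volume.real S * (l * P) := by
          rw [integral_indicator hSm, setIntegral_const, smul_eq_mul]
      _ ≤ _ := mul_le_mul_of_nonneg_right hvol (by positivity)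
  calc _ ≤ _ := h1
    _ ≤ (l + M) * (s * (b - a) * (l * P)) := mul_le_mul_of_nonneg_left h2 hlM.le
    _ = l ^ 2 * P * (b - a) := by
      rw [hs]
      field_simp

/-- A strictly convex function orthogonal to a nontrivial nonnegative weight is positive at one of
the endpoints. -/
lemma StrictConvexOn.endpoint_pos_of_setIntegral_mul_eq_zero {a b : ℝ} {h p : ℝ → ℝ} (hab : a < b)
    (hc : StrictConvexOn ℝ (Set.Icc a b) h) (hcont : ContinuousOn h (Set.Icc a b))
    (hp : ContinuousOn p (Set.Icc a b)) (hpnn : ∀ x ∈ Set.Icc a b, 0 ≤ p x)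
    (hpint : 0 < ∫ x in Set.Icc a b, p x)
    (horth : ∫ x in Set.Icc a b, h x * p x = 0) : 0 < h a ∨ 0 < h b := by
  by_contra! hneg
  have hlt : ∀ x ∈ Set.Ioo a b, h x < 0 := fun x hx =>
    (hc.lt_on_openSegment (Set.left_mem_Icc.2 hab.le) (Set.right_mem_Icc.2 hab.le) hab.ne
      (by rwa [openSegment_eq_Ioo hab])).trans_le (max_le hneg.1 hneg.2)
  rw [integral_Icc_eq_integral_Ioo] at horth hpint
  have hpnn' : ∀ x ∈ Set.Ioo a b, 0 ≤ p x := fun x hx => hpnn x (Set.Ioo_subset_Icc_self hx)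
  have int_hp : IntegrableOn (fun x => -(h x * p x)) (Set.Ioo a b) :=
    (hcont.mul hp).integrableOn_Icc.neg.mono_set Set.Ioo_subset_Icc_self
  have hae : ∀ᵐ x ∂volume.restrict (Set.Ioo a b), x ∈ Set.Ioo a b :=
    ae_restrict_mem measurableSet_Ioo
  have hzero := (integral_eq_zero_iff_of_nonneg_ae (by
    filter_upwards [hae] with x hx
    exact neg_nonneg.2 (mul_nonpos_of_nonpos_of_nonneg (hlt x hx).le (hpnn' x hx))) int_hp).1
    (by rw [integral_neg, horth, neg_zero])
  refine hpint.ne' (integral_eq_zero_of_ae ?_)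
  filter_upwards [hzero, hae] with x hx0 hx
  exact (mul_eq_zero.1 (neg_eq_zero.1 hx0)).resolve_left (hlt x hx).ne

theorem statement_18
    (a b : ℝ) (hab : a < b) (f f' p : ℝ → ℝ) (A B : ℝ)
    -- `f ∈ C¹([a,b], ℝ)` with derivative `f'`
    (hderiv : ∀ x ∈ Set.Icc a b, HasDerivWithinAt f (f' x) (Set.Icc a b) x)
    (hf'c : ContinuousOn f' (Set.Icc a b))
    (hf'pos : ∀ x ∈ Set.Icc a b, 0 < f' x)
    (hp : ContinuousOn p (Set.Icc a b))
    (hpnn : ∀ x ∈ Set.Icc a b, 0 ≤ p x)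
    (hpint : 0 < ∫ x in Set.Icc a b, |p x|)
    (hconv : StrictConvexOn ℝ (Set.Icc a b) f)
    -- the affine linear function is `g(x) = A x + B`
    (hortho : ∫ x in Set.Icc a b, (f x - (A * x + B)) * p x = 0) :
    (∃ x ∈ ({a, b} : Set ℝ), A * x + B < f x) ∧
      ∀ lam : ℝ,
        lam = sSup {r : ℝ | ∃ x ∈ ({a, b} : Set ℝ), A * x + B < f x ∧ r = |f x - (A * x + B)|} →
        ∫ x in Set.Icc a b, (f x - (A * x + B)) ^ 2 * p x ≤
          lam * (lam + sSup (f' '' Set.Icc a b)) * sSup (p '' Set.Icc a b) * (b - a) := by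
  have hab' := hab.le
  have hfc : ContinuousOn f (Set.Icc a b) := fun x hx => (hderiv x hx).continuousWithinAt
  set h : ℝ → ℝ := fun x => f x - (A * x + B) with hh
  have hcont : ContinuousOn h (Set.Icc a b) := hfc.sub (by fun_prop)
  have hc : StrictConvexOn ℝ (Set.Icc a b) h := by
    refine ⟨hconv.1, fun x hx y hy hxy s t hs ht hst => ?_⟩
    have key := hconv.2 hx hy hxy hs ht hst
    obtain rfl : t = 1 - s := by linarith
    simp only [hh, smul_eq_mul] at key ⊢
    linarith
  have hpint' : 0 < ∫ x in Set.Icc a b, p x := by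
    rwa [← setIntegral_congr_fun measurableSet_Icc fun x hx => abs_of_nonneg (hpnn x hx)]
  have hend := hc.endpoint_pos_of_setIntegral_mul_eq_zero hab hcont hp hpnn hpint' hortho
  have hex : ∃ x ∈ ({a, b} : Set ℝ), A * x + B < f x := by
    rcases hend with h0 | h0
    · exact ⟨a, by simp, sub_pos.1 h0⟩
    · exact ⟨b, by simp, sub_pos.1 h0⟩
  refine ⟨hex, ?_⟩
  rintro lam hlam
  have hbdd : BddAbove
      {r : ℝ | ∃ x ∈ ({a, b} : Set ℝ), A * x + B < f x ∧ r = |f x - (A * x + B)|} := by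
    refine ⟨max |h a| |h b|, ?_⟩
    rintro r ⟨x, rfl | rfl, -, rfl⟩
    · exact le_max_left _ _
    · exact le_max_right _ _
  have hle : ∀ x ∈ ({a, b} : Set ℝ), 0 < h x → h x ≤ lam := fun x hx h0 =>
    (le_abs_self _).trans (hlam ▸ le_csSup hbdd ⟨x, hx, sub_pos.1 h0, rfl⟩)
  have hlpos : 0 < lam := by
    obtain ⟨x, hx, h0⟩ := hex
    exact (sub_pos.2 h0).trans_le (hle x hx (sub_pos.2 h0))
  have hle' : ∀ x ∈ ({a, b} : Set ℝ), h x ≤ lam := fun x hx =>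
    (le_or_gt (h x) 0).elim (fun h0 => h0.trans hlpos.le) (hle x hx)
  have hpP : ∀ x ∈ Set.Icc a b, p x ≤ sSup (p '' Set.Icc a b) := fun x hx =>
    le_csSup (isCompact_Icc.bddAbove_image hp) (Set.mem_image_of_mem p hx)
  have hP : 0 ≤ sSup (p '' Set.Icc a b) :=
    Real.sSup_nonneg (Set.forall_mem_image.2 hpnn)
  have hD : 0 ≤ sSup (f' '' Set.Icc a b) :=
    Real.sSup_nonneg (Set.forall_mem_image.2 fun x hx => (hf'pos x hx).le)
  refine (hc.convexOn.setIntegral_sq_mul_le hab' hcont hp hpnn hpP hpint' hortho hlpos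
    (hle' a (by simp)) (hle' b (by simp))).trans ?_
  rw [sq]
  have hba : 0 ≤ b - a := sub_nonneg.2 hab'
  gcongr
  linarith
end
end
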